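/- Let A be a generic (2n+1) × (2n+1) skew-symmetric matrix over a field k, B the (2n+1) × j matrix whose top (2n+1−j) × j block is zero and bottom j × j block is the identity, and T the block skew-symmetric matrix [[A, B],[−Bᵀ, 0]]. Then the Pfaffian of any even-sized principal submatrix of T containing all of A equals, up to sign, the Pfaffian of the submatrix of A obtained by deleting the rows and columns of A that pair with the selected identity columns of B. -/

import Mathlib

/-- The Pfaffian of a `2k × 2k` matrix over a `ℚ`-algebra, via the summation formula
`Pf(M) = (2^k k!)⁻¹ Σ_σ sgn(σ) Π_i M_{σ(2i),σ(2i+1)}`. -/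
noncomputable def pfaffian {R : Type*} [CommRing R] [Algebra ℚ R] {k : ℕ}
    (M : Matrix (Fin (2 * k)) (Fin (2 * k)) R) : R :=
  ((2 ^ k * k.factorial : ℚ)⁻¹) • ∑ σ : Equiv.Perm (Fin (2 * k)),
    (Equiv.Perm.sign σ : ℤ) • ∏ i : Fin k,
      M (σ ⟨2 * i, by have := i.isLt; omega⟩) (σ ⟨2 * i + 1, by have := i.isLt; omega⟩)

/-- The generic `m × m` skew-symmetric matrix of indeterminates. -/
noncomputable def genSkew (m : ℕ) :
    Matrix (Fin m) (Fin m) (MvPolynomial (Fin m × Fin m) ℚ) :=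
  fun p q => if p < q then MvPolynomial.X (p, q)
    else if q < p then -MvPolynomial.X (q, p) else 0

/-- The `(2n+1) × j` matrix `B` whose top `(2n+1−j) × j` block is zero and whose
bottom `j × j` block is the identity. -/
noncomputable def Bmat (n j : ℕ) :
    Matrix (Fin (2 * n + 1)) (Fin j) (MvPolynomial (Fin (2 * n + 1) × Fin (2 * n + 1)) ℚ) :=
  fun p q => if (p : ℕ) = 2 * n + 1 - j + (q : ℕ) then 1 else 0

/-- The signed monomial attached to a permutation `σ` of `Fin k × Bool` in the Pfaffian of `M`. -/
def pfaffianTerm {R : Type*} [CommRing R] {k : ℕ}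
    (M : Matrix (Fin k × Bool) (Fin k × Bool) R) (σ : Equiv.Perm (Fin k × Bool)) : R :=
  (Equiv.Perm.sign σ : ℤ) • ∏ i : Fin k, M (σ (i, false)) (σ (i, true))

/-- The Pfaffian of a matrix whose rows and columns are indexed by `Fin k × Bool`. -/
noncomputable def pairedPfaffian {R : Type*} [CommRing R] [Algebra ℚ R] {k : ℕ}
    (M : Matrix (Fin k × Bool) (Fin k × Bool) R) : R :=
  ((2 ^ k * k.factorial : ℚ)⁻¹) • ∑ σ, pfaffianTerm M σ

/-- The bijection sending `(i, false)` to `2 * i` and `(i, true)` to `2 * i + 1`. -/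
def pairEquiv (k : ℕ) : Fin k × Bool ≃ Fin (2 * k) where
  toFun x := ⟨2 * x.1 + x.2.toNat, by have := x.1.isLt; have := x.2.toNat_le; omega⟩
  invFun y := (⟨y / 2, by omega⟩, decide ((y : ℕ) % 2 = 1))
  left_inv := by
    rintro ⟨i, _ | _⟩ <;> ext <;> simp; omega
  right_inv := by
    intro y
    ext
    rcases Nat.mod_two_eq_zero_or_one y with h | h <;> simp [h] <;> omega

section

variable {R : Type*} [CommRing R] {k : ℕ}

theorem pfaffianTerm_submatrix (M : Matrix (Fin k × Bool) (Fin k × Bool) R)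
    (ρ σ : Equiv.Perm (Fin k × Bool)) :
    pfaffianTerm (M.submatrix ρ ρ) σ = (Equiv.Perm.sign ρ : ℤ) • pfaffianTerm M (ρ * σ) := by
  have h : ((Equiv.Perm.sign ρ : ℤ)) * (Equiv.Perm.sign ρ : ℤ) = 1 := by
    rcases Int.units_eq_one_or (Equiv.Perm.sign ρ) with h | h <;> simp [h]
  simp only [pfaffianTerm, Equiv.Perm.sign_mul, smul_smul, Units.val_mul, ← mul_assoc, h, one_mul,
    Matrix.submatrix_apply, Equiv.Perm.mul_apply]

theorem pairedPfaffian_submatrix [Algebra ℚ R] (M : Matrix (Fin k × Bool) (Fin k × Bool) R)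
    (ρ : Equiv.Perm (Fin k × Bool)) :
    pairedPfaffian (M.submatrix ρ ρ) = (Equiv.Perm.sign ρ : ℤ) • pairedPfaffian M := by
  simp only [pairedPfaffian, pfaffianTerm_submatrix]
  rw [← Finset.smul_sum, smul_comm, ← Equiv.sum_comp (Equiv.mulLeft ρ) (pfaffianTerm M)]
  rfl

theorem pfaffian_eq_pairedPfaffian [Algebra ℚ R] (M : Matrix (Fin (2 * k)) (Fin (2 * k)) R) :
    pfaffian M = pairedPfaffian (M.submatrix (pairEquiv k) (pairEquiv k)) := by
  unfold pfaffian pairedPfaffian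
  congr 1
  rw [← Equiv.sum_comp (pairEquiv k).permCongr]
  refine Finset.sum_congr rfl fun σ _ => ?_
  simp only [pfaffianTerm, Equiv.Perm.sign_permCongr]
  congr 1
  refine Finset.prod_congr rfl fun i _ => ?_
  have h0 : (pairEquiv k).symm ⟨2 * i, by have := i.isLt; omega⟩ = (i, false) := by
    rw [Equiv.symm_apply_eq]; simp [pairEquiv]
  have h1 : (pairEquiv k).symm ⟨2 * i + 1, by have := i.isLt; omega⟩ = (i, true) := by
    rw [Equiv.symm_apply_eq]; simp [pairEquiv]
  simp [Equiv.permCongr_apply, h0, h1]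

theorem pfaffian_submatrix_eq [Algebra ℚ R] {X : Type*} (M : Matrix X X R)
    (e : Fin (2 * k) ≃ X) (E : Fin k × Bool ≃ X) :
    ∃ ε : ℤ, (ε = 1 ∨ ε = -1) ∧
      pfaffian (M.submatrix e e) = ε • pairedPfaffian (M.submatrix E E) := by
  refine ⟨Equiv.Perm.sign (((pairEquiv k).trans e).trans E.symm), ?_, ?_⟩
  · rcases Int.units_eq_one_or (Equiv.Perm.sign (((pairEquiv k).trans e).trans E.symm))
      with h | h <;> simp [h]
  · rw [pfaffian_eq_pairedPfaffian, ← pairedPfaffian_submatrix]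
    congr 1
    ext x y
    simp

theorem pfaffianTerm_mul_prodCongrLeft (M : Matrix (Fin k × Bool) (Fin k × Bool) R)
    (σ : Equiv.Perm (Fin k × Bool)) (π : Equiv.Perm (Fin k)) :
    pfaffianTerm M (σ * Equiv.prodCongrLeft fun _ => π) = pfaffianTerm M σ := by
  have h : Equiv.Perm.sign (Equiv.prodCongrLeft fun _ : Bool => π) = 1 := by
    rw [Equiv.Perm.sign_prodCongrLeft]
    rcases Int.units_eq_one_or (Equiv.Perm.sign π) with h | h <;> simp [h]
  simp only [pfaffianTerm, Equiv.Perm.sign_mul, h, mul_one, Equiv.Perm.mul_apply,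
    Equiv.prodCongrLeft_apply]
  rw [Equiv.prod_comp π (fun i => M (σ (i, false)) (σ (i, true)))]

theorem pfaffianTerm_mul_flip (M : Matrix (Fin k × Bool) (Fin k × Bool) R)
    (hM : ∀ x y, M x y = -M y x) (σ : Equiv.Perm (Fin k × Bool)) (i : Fin k) :
    pfaffianTerm M (σ * Equiv.Perm.prodExtendRight i Equiv.boolNot) = pfaffianTerm M σ := by
  have h : Equiv.Perm.sign Equiv.boolNot = -1 := by decide
  simp only [pfaffianTerm, Equiv.Perm.sign_mul, Equiv.Perm.sign_prodExtendRight, h,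
    Equiv.Perm.mul_apply]
  rw [← Finset.mul_prod_erase _ _ (Finset.mem_univ i),
    ← Finset.mul_prod_erase Finset.univ (fun i => M (σ (i, false)) (σ (i, true)))
      (Finset.mem_univ i)]
  have hr : ∀ x ∈ Finset.univ.erase i,
      M (σ (Equiv.Perm.prodExtendRight i Equiv.boolNot (x, false)))
        (σ (Equiv.Perm.prodExtendRight i Equiv.boolNot (x, true))) =
      M (σ (x, false)) (σ (x, true)) := by
    intro x hx
    rw [Equiv.Perm.prodExtendRight_apply_ne _ (Finset.ne_of_mem_erase hx),
      Equiv.Perm.prodExtendRight_apply_ne _ (Finset.ne_of_mem_erase hx)]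
  rw [Finset.prod_congr rfl hr, Equiv.Perm.prodExtendRight_apply_eq,
    Equiv.Perm.prodExtendRight_apply_eq]
  simp only [Equiv.boolNot_apply, Bool.not_false, Bool.not_true]
  rw [hM (σ (i, true))]
  simp

/-- Every position can be moved to any other by a permutation preserving all Pfaffian terms. -/
theorem exists_pfaffianTerm_mul_eq (M : Matrix (Fin k × Bool) (Fin k × Bool) R)
    (hM : ∀ x y, M x y = -M y x) (p : Fin k × Bool) (i : Fin k) :
    ∃ g : Equiv.Perm (Fin k × Bool), g p = (i, true) ∧
      ∀ σ, pfaffianTerm M (σ * g) = pfaffianTerm M σ := by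
  obtain ⟨a, _ | _⟩ := p
  · refine ⟨Equiv.Perm.prodExtendRight i Equiv.boolNot *
      Equiv.prodCongrLeft fun _ => Equiv.swap a i, by simp, fun σ => ?_⟩
    rw [← mul_assoc, pfaffianTerm_mul_prodCongrLeft, pfaffianTerm_mul_flip M hM]
  · exact ⟨Equiv.prodCongrLeft fun _ => Equiv.swap a i, by simp,
      fun σ => pfaffianTerm_mul_prodCongrLeft M σ _⟩

theorem sum_pfaffianTerm_eq (M : Matrix (Fin k × Bool) (Fin k × Bool) R)
    (hM : ∀ x y, M x y = -M y x) (i : Fin k) :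
    ∑ σ, pfaffianTerm M σ =
      (2 * k) • ∑ σ : Equiv.Perm (Fin k × Bool),
        if σ (i, true) = (i, true) then pfaffianTerm M σ else 0 := by
  have h1 : ∀ σ : Equiv.Perm (Fin k × Bool), pfaffianTerm M σ =
      ∑ p, if σ p = (i, true) then pfaffianTerm M σ else 0 := by
    intro σ
    simp [← Equiv.eq_symm_apply]
  rw [Finset.sum_congr rfl fun σ _ => h1 σ, Finset.sum_comm]
  have h2 : ∀ p, (∑ σ : Equiv.Perm (Fin k × Bool),
      if σ p = (i, true) then pfaffianTerm M σ else 0) =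
      ∑ σ : Equiv.Perm (Fin k × Bool),
        if σ (i, true) = (i, true) then pfaffianTerm M σ else 0 := by
    intro p
    obtain ⟨g, hg, h⟩ := exists_pfaffianTerm_mul_eq M hM p i
    rw [← Equiv.sum_comp (Equiv.mulRight g)]
    simp [hg, h]
  rw [Finset.sum_congr rfl fun p _ => h2 p]
  simp [mul_comm]

/-- The inclusion of the first `k` pairs of indices. -/
def castSuccPair (k : ℕ) : Fin k × Bool ↪ Fin (k + 1) × Bool :=
  Fin.castSuccEmb.prodMap (Function.Embedding.refl Bool)

theorem castSuccPair_apply (i : Fin k) (b : Bool) :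
    castSuccPair k (i, b) = (i.castSucc, b) := rfl

theorem last_notMem_range_castSuccPair (b : Bool) :
    (Fin.last k, b) ∉ Set.range (castSuccPair k) := by
  rintro ⟨⟨i, c⟩, h⟩
  rw [castSuccPair_apply, Prod.mk.injEq] at h
  exact (Fin.castSucc_ne_last i) h.1

theorem mem_range_castSuccPair {x : Fin (k + 1) × Bool} (h : x.1 ≠ Fin.last k) :
    x ∈ Set.range (castSuccPair k) := by
  obtain ⟨i, hi⟩ := Fin.exists_castSucc_eq.2 h
  exact ⟨(i, x.2), by rw [castSuccPair_apply, hi]⟩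

theorem exists_viaFintypeEmbedding_eq (σ : Equiv.Perm (Fin (k + 1) × Bool))
    (h : ∀ b, σ (Fin.last k, b) = (Fin.last k, b)) :
    ∃ τ : Equiv.Perm (Fin k × Bool), τ.viaFintypeEmbedding (castSuccPair k) = σ := by
  have hσ : ∀ x, x ∈ Set.range (castSuccPair k) → σ x ∈ Set.range (castSuccPair k) := by
    intro x hx
    apply mem_range_castSuccPair
    intro hl
    have : σ x = σ (Fin.last k, (σ x).2) := by rw [h, ← hl]
    rw [σ.injective this] at hx
    exact last_notMem_range_castSuccPair _ hx
  choose f hf using fun y => hσ (castSuccPair k y) ⟨y, rfl⟩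
  have hinj : Function.Injective f := by
    intro y z hyz
    have := (hf y).symm.trans ((congrArg _ hyz).trans (hf z))
    exact (castSuccPair k).injective (σ.injective this)
  refine ⟨Equiv.ofBijective f (Finite.injective_iff_bijective.1 hinj), ?_⟩
  ext1 x
  by_cases hx : x.1 = Fin.last k
  · obtain ⟨a, b⟩ := x
    obtain rfl : a = Fin.last k := hx
    rw [Equiv.Perm.viaFintypeEmbedding_apply_notMem_range _ _
      (last_notMem_range_castSuccPair b), h]
  · obtain ⟨y, rfl⟩ := mem_range_castSuccPair hx
    rw [Equiv.Perm.viaFintypeEmbedding_apply_image, Equiv.ofBijective_apply, hf]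

theorem sum_pfaffianTerm_castSuccPair
    (M : Matrix (Fin (k + 1) × Bool) (Fin (k + 1) × Bool) R)
    (hl : ∀ x, M x (Fin.last k, true) = if x = (Fin.last k, false) then 1 else 0) :
    ∑ τ, pfaffianTerm (M.submatrix (castSuccPair k) (castSuccPair k)) τ =
      ∑ σ : Equiv.Perm (Fin (k + 1) × Bool),
        if σ (Fin.last k, true) = (Fin.last k, true) then pfaffianTerm M σ else 0 := by
  refine Finset.sum_of_injOn (fun τ => τ.viaFintypeEmbedding (castSuccPair k)) ?_ ?_ ?_ ?_
  · intro τ _ τ' _ h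
    ext1 x
    apply (castSuccPair k).injective
    rw [← Equiv.Perm.viaFintypeEmbedding_apply_image,
      ← Equiv.Perm.viaFintypeEmbedding_apply_image]
    exact congrArg (fun σ : Equiv.Perm (Fin (k + 1) × Bool) => σ (castSuccPair k x)) h
  · simp
  · intro σ _ hσ
    split_ifs with h
    · have h' : σ (Fin.last k, false) ≠ (Fin.last k, false) := by
        intro h'
        obtain ⟨τ, hτ⟩ := exists_viaFintypeEmbedding_eq σ (by rintro (_ | _) <;> assumption)
        exact hσ ⟨τ, by simp, hτ⟩
      rw [pfaffianTerm, Fin.prod_univ_castSucc, h, hl, if_neg h', mul_zero, smul_zero]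
    · rfl
  · intro τ _
    rw [Equiv.Perm.viaFintypeEmbedding_apply_notMem_range _ _
      (last_notMem_range_castSuccPair true), if_pos rfl, pfaffianTerm, pfaffianTerm,
      Equiv.Perm.viaFintypeEmbedding_sign, Fin.prod_univ_castSucc,
      Equiv.Perm.viaFintypeEmbedding_apply_notMem_range _ _
      (last_notMem_range_castSuccPair true),
      Equiv.Perm.viaFintypeEmbedding_apply_notMem_range _ _
      (last_notMem_range_castSuccPair false), hl, if_pos rfl, mul_one]
    simp only [← castSuccPair_apply, Equiv.Perm.viaFintypeEmbedding_apply_image,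
      Matrix.submatrix_apply]

theorem pairedPfaffian_eq_castSuccPair [Algebra ℚ R]
    (M : Matrix (Fin (k + 1) × Bool) (Fin (k + 1) × Bool) R) (hM : ∀ x y, M x y = -M y x)
    (hl : ∀ x, M x (Fin.last k, true) = if x = (Fin.last k, false) then 1 else 0) :
    pairedPfaffian M = pairedPfaffian (M.submatrix (castSuccPair k) (castSuccPair k)) := by
  rw [pairedPfaffian, sum_pfaffianTerm_eq M hM (Fin.last k), ← sum_pfaffianTerm_castSuccPair M hl,
    pairedPfaffian, ← Nat.cast_smul_eq_nsmul ℚ, smul_smul]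
  congr 1
  rw [Nat.factorial_succ]
  have : (k.factorial : ℚ) ≠ 0 := by exact_mod_cast k.factorial_ne_zero
  push_cast
  field_simp
  ring

/-- If the columns `(l, true)` of an alternating matrix, for `l` among the last `t` pairs, are unit
vectors supported at `(l, false)`, then these pairs can be deleted without changing the Pfaffian. -/
theorem pairedPfaffian_eq_castAdd [Algebra ℚ R] (t : ℕ)
    (M : Matrix (Fin (k + t) × Bool) (Fin (k + t) × Bool) R) (hM : ∀ x y, M x y = -M y x)
    (hl : ∀ (l : Fin t) x, M x (Fin.natAdd k l, true) =
      if x = (Fin.natAdd k l, false) then 1 else 0) :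
    pairedPfaffian M = pairedPfaffian
      (M.submatrix (Prod.map (Fin.castAdd t) id) (Prod.map (Fin.castAdd t) id)) := by
  induction t with
  | zero => rfl
  | succ t ih =>
    rw [pairedPfaffian_eq_castSuccPair (k := k + t) M hM (hl (Fin.last t)), ih]
    · rfl
    · exact fun x y => hM _ _
    · intro l x
      refine (hl l.castSucc (castSuccPair (k + t) x)).trans ?_
      refine if_congr ?_ rfl rfl
      exact (castSuccPair (k + t)).injective.eq_iff (b := (Fin.natAdd k l, false))

end

theorem genSkew_apply_neg (m : ℕ) (p q : Fin m) : genSkew m p q = -genSkew m q p := by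
  unfold genSkew
  rcases lt_trichotomy p q with h | rfl | h
  · simp [h, h.not_gt]
  · simp
  · simp [h, h.not_gt]

/-- The enumeration of `α ⊕ S` by pairs in which the first `k` pairs exhaust the elements of `α`
outside the image of `f`, and each later pair consists of `f s` and `s` for some `s : S`. -/
def pairedEnum {α S : Type*} {p : α → Prop} {k t : ℕ} (e' : Fin (2 * k) ≃ {a : α // p a})
    (c : Fin t ≃ S) (f : S → α) (x : Fin (k + t) × Bool) : α ⊕ S :=
  Fin.addCases (fun i => Sum.inl (e' (pairEquiv k (i, x.2))).1)
    (fun l => if x.2 then Sum.inr (c l) else Sum.inl (f (c l))) x.1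

theorem pairedEnum_injective {α S : Type*} {p : α → Prop} {k t : ℕ}
    (e' : Fin (2 * k) ≃ {a : α // p a}) (c : Fin t ≃ S) (f : S → α) (hf : Function.Injective f)
    (hp : ∀ s, ¬p (f s)) : Function.Injective (pairedEnum e' c f) := by
  have h : ∀ y s, (e' y).1 ≠ f s := fun y s h => hp s (h ▸ (e' y).2)
  rintro ⟨x, b⟩ ⟨y, b'⟩
  induction x using Fin.addCases with
  | left x =>
    induction y using Fin.addCases with
    | left y =>
      simp only [pairedEnum, Fin.addCases_left, Sum.inl.injEq]
      intro hxy
      have := (pairEquiv k).injective (e'.injective (Subtype.ext hxy))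
      simpa using this
    | right y => cases b' <;> simp [pairedEnum, h]
  | right x =>
    induction y using Fin.addCases with
    | left y => cases b <;> simp [pairedEnum, (h _ _).symm]
    | right y => cases b <;> cases b' <;> simp [pairedEnum, hf.eq_iff]


/-- Let `A` be the generic `(2n+1) × (2n+1)` skew-symmetric matrix, `B` as above and
`T = [[A, B], [−Bᵀ, 0]]`.  The Pfaffian of any even-sized principal submatrix of `T`
containing all of `A` (given by a subset `S` of the last `j` indices, necessarily of
odd cardinality `2m+1`) equals, up to sign, the Pfaffian of the submatrix of `A`
obtained by deleting the rows and columns of `A` that pair with the selected identity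
columns of `B`. -/
theorem pfaffian_principal_submatrix (n j m : ℕ) (hj : j ≤ 2 * n + 1) (hmn : m ≤ n)
    (S : Finset (Fin j)) (hS : S.card = 2 * m + 1)
    (e : Fin (2 * (n + m + 1)) ≃ (Fin (2 * n + 1) ⊕ {s : Fin j // s ∈ S}))
    (e' : Fin (2 * (n - m)) ≃
      {i : Fin (2 * n + 1) // ∀ s ∈ S, (i : ℕ) ≠ 2 * n + 1 - j + (s : ℕ)}) :
    let A := genSkew (2 * n + 1)
    let T := Matrix.fromBlocks A (Bmat n j) (-(Bmat n j).transpose) 0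
    ∃ ε : MvPolynomial (Fin (2 * n + 1) × Fin (2 * n + 1)) ℚ, (ε = 1 ∨ ε = -1) ∧
      pfaffian (T.submatrix (Sum.map id Subtype.val ∘ e) (Sum.map id Subtype.val ∘ e))
        = ε * pfaffian (A.submatrix (Subtype.val ∘ e') (Subtype.val ∘ e')) := by
  intro A T
  have hT : ∀ x y, T x y = -T y x := by
    rintro (x | x) (y | y)
    · exact genSkew_apply_neg _ x y
    all_goals simp [T]
  let f : {s // s ∈ S} → Fin (2 * n + 1) := fun s => ⟨2 * n + 1 - j + s.1, by omega⟩
  have hf : Function.Injective f := fun s s' h => by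
    have h' := Fin.val_eq_of_eq h
    exact Subtype.ext (Fin.ext (Nat.add_left_cancel h'))
  let c : Fin (2 * m + 1) ≃ {s // s ∈ S} := (S.equivFinOfCardEq hS).symm
  have hinj := pairedEnum_injective e' c f hf fun s h => h s.1 s.2 rfl
  have hcard := Fintype.card_congr e
  have hN : n + m + 1 = n - m + (2 * m + 1) := by omega
  let E : Fin (n - m + (2 * m + 1)) × Bool ≃ Fin (2 * n + 1) ⊕ {s // s ∈ S} :=
    Equiv.ofBijective _ ((Fintype.bijective_iff_injective_and_card _).2
      ⟨hinj, by rw [← hcard]; simp; omega⟩)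
  let r : Fin (2 * n + 1) ⊕ {s // s ∈ S} → Fin (2 * n + 1) ⊕ Fin j := Sum.map id Subtype.val
  let T' := T.submatrix r r
  have hE : pairedPfaffian (T'.submatrix E E) =
      pairedPfaffian ((A.submatrix (Subtype.val ∘ e') (Subtype.val ∘ e')).submatrix
        (pairEquiv (n - m)) (pairEquiv (n - m))) := by
    rw [pairedPfaffian_eq_castAdd (2 * m + 1) (T'.submatrix E E) fun x y => hT _ _]
    · congr 1
      ext1 x y
      simp [E, T', T, r, pairedEnum]
    · intro l x
      have h1 : E (Fin.natAdd (n - m) l, true) = Sum.inr (c l) := by simp [E, pairedEnum]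
      have h0 : E (Fin.natAdd (n - m) l, false) = Sum.inl (f (c l)) := by simp [E, pairedEnum]
      have hx : x = (Fin.natAdd (n - m) l, false) ↔ E x = Sum.inl (f (c l)) := by
        rw [← h0, E.injective.eq_iff]
      simp only [Matrix.submatrix_apply, h1, hx]
      rcases E x with y | y
      · simp [T', T, r, Bmat, f, Fin.ext_iff]
      · simp [T', T, r]
  obtain ⟨ε, hε, h⟩ : ∃ ε : ℤ, (ε = 1 ∨ ε = -1) ∧
      pfaffian (T'.submatrix e e) = ε • pairedPfaffian (T'.submatrix E E) := by
    clear_value E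
    clear hE
    revert E
    rw [← hN]
    exact pfaffian_submatrix_eq T' e
  refine ⟨ε, by rcases hε with rfl | rfl <;> simp, ?_⟩
  rw [pfaffian_eq_pairedPfaffian (A.submatrix _ _), ← hE, ← zsmul_eq_mul]
  exact h
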